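/- Let n ≥ 5 and let P, Q : Fin n → ℝ² be two configurations of n labeled points (injective, in general position) with the same undirected radial system, i.e., for every index i the relation ccw_Q(i;·,·,·) equals ccw_P(i;·,·,·) or its reverse. If the extreme set of P has at least 4 elements, then the chirotopes of P and Q are equivalent: either χ_P(i,j,k) = χ_Q(i,j,k) for all i,j,k, or χ_P(i,j,k) = −χ_Q(i,j,k) for all i,j,k. -/

import Mathlib

noncomputable def det2 (v w : ℝ × ℝ) : ℝ := v.1 * w.2 - v.2 * w.1

noncomputable def chi {α : Type*} (P : α → ℝ × ℝ) (i j k : α) : ℝ :=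
  Real.sign (det2 (P j - P i) (P k - P i))

def GenPos {α : Type*} (P : α → ℝ × ℝ) : Prop :=
  ∀ i j k : α, i ≠ j → i ≠ k → j ≠ k → chi P i j k ≠ 0

def Ccw {α : Type*} (P : α → ℝ × ℝ) (i j k l : α) : Prop :=
  (chi P i j k = 1 ∧ chi P i k l = 1) ∨
  (chi P i k l = 1 ∧ chi P i l j = 1) ∨
  (chi P i l j = 1 ∧ chi P i j k = 1)

def Admissible {α : Type*} (i j k l : α) : Prop :=
  i ≠ j ∧ i ≠ k ∧ i ≠ l ∧ j ≠ k ∧ j ≠ l ∧ k ≠ l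

def SameRadial {α : Type*} (P Q : α → ℝ × ℝ) : Prop :=
  ∀ i j k l : α, Admissible i j k l → (Ccw P i j k l ↔ Ccw Q i j k l)

def SameUndirected {α : Type*} (P Q : α → ℝ × ℝ) : Prop :=
  ∀ i : α, (∀ j k l : α, Admissible i j k l → (Ccw Q i j k l ↔ Ccw P i j k l)) ∨
           (∀ j k l : α, Admissible i j k l → (Ccw Q i j k l ↔ Ccw P i l k j))

def ExtremeSet {α : Type*} (P : α → ℝ × ℝ) : Set α :=
  {i | P i ∉ convexHull ℝ (P '' {j | j ≠ i})}

def Important {n : ℕ} (P₀ : Fin n → ℝ × ℝ) (H : Set (Fin n)) : Prop :=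
  ∃ Q : Fin n → ℝ × ℝ, Function.Injective Q ∧ GenPos Q ∧ SameRadial P₀ Q ∧ ExtremeSet Q = H

def lineThrough (p q : ℝ × ℝ) : Set (ℝ × ℝ) := {x | ∃ t : ℝ, x = p + t • (q - p)}

/-- The majority value of three signs. -/
def majority (x y z : Bool) : Bool := x && y || y && z || z && x

/-- Three signs that are not all equal. -/
def Mixed (x y z : Bool) : Prop := ¬(x = y ∧ y = z)

instance (x y z : Bool) : Decidable (Mixed x y z) := inferInstanceAs (Decidable (¬_))

/-- Orientation signs of the pairs among four plane vectors `j, k, l, m` that do not positively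
span the plane: no three of them surround the origin. -/
def PointedSigns (jk jl jm kl km lm : Bool) : Prop :=
  Mixed jk kl !jl ∧ Mixed jk km !jm ∧ Mixed jl lm !jm ∧ Mixed kl lm !km

instance (jk jl jm kl km lm : Bool) : Decidable (PointedSigns jk jl jm kl km lm) :=
  inferInstanceAs (Decidable (_ ∧ _))

/-- Two sign functions on the pairs of four vectors induce the same cyclic order on the vectors,
up to reversal. -/
def SameCycle (jk jl jm kl km lm jk' jl' jm' kl' km' lm' : Bool) : Prop :=
  ∃ δ, (majority jk kl !jl ^^ majority jk' kl' !jl') = δ ∧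
    (majority jk km !jm ^^ majority jk' km' !jm') = δ ∧
    (majority jl lm !jm ^^ majority jl' lm' !jm') = δ ∧
    (majority kl lm !km ^^ majority kl' lm' !km') = δ

instance (jk jl jm kl km lm jk' jl' jm' kl' km' lm' : Bool) :
    Decidable (SameCycle jk jl jm kl km lm jk' jl' jm' kl' km' lm') :=
  inferInstanceAs (Decidable (∃ _, _))

set_option maxRecDepth 10000 in
set_option synthInstance.maxSize 1000 in
set_option synthInstance.maxHeartbeats 400000 in
/-- Five points `a, b, c, d, e` such that `a, b, c` lie in no triangle of the others and `d` lies
outside the triangle `abc`: the undirected cyclic orders determine the orientations up to a global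
sign. -/
theorem sign_rigidity_of_sameCycle :
    ∀ abc abd abe acd ace ade bcd bce bde cde : Bool,
      PointedSigns abc abd abe acd ace ade → PointedSigns (!abc) (!abd) (!abe) bcd bce bde →
      PointedSigns abc (!acd) (!ace) (!bcd) (!bce) cde → Mixed abd bcd !acd →
    ∀ abc' abd' abe' acd' ace' ade' : Bool,
      SameCycle abc abd abe acd ace ade abc' abd' abe' acd' ace' ade' →
    ∀ bcd' bce' bde' : Bool,
      SameCycle (!abc) (!abd) (!abe) bcd bce bde (!abc') (!abd') (!abe') bcd' bce' bde' →
    ∀ cde' : Bool,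
      SameCycle abc (!acd) (!ace) (!bcd) (!bce) cde
        abc' (!acd') (!ace') (!bcd') (!bce') cde' →
      SameCycle abd acd (!ade) bcd (!bde) (!cde) abd' acd' (!ade') bcd' (!bde') (!cde') →
      SameCycle abe ace ade bce bde cde abe' ace' ade' bce' bde' cde' →
    ∀ s ∈ [abd ^^ abd', abe ^^ abe', acd ^^ acd', ace ^^ ace', ade ^^ ade', bcd ^^ bcd',
      bce ^^ bce', bde ^^ bde', cde ^^ cde'], s = (abc ^^ abc') := by
  decide +kernel

/-- If four of five points `a, b, c, d, e` lie in no triangle of the others, then `e` lies outside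
one of the triangles `abc`, `abd`, `acd`. -/
theorem exists_mixed_of_pointedSigns :
    ∀ abc abd abe acd ace ade bcd bce bde cde : Bool,
      PointedSigns abc abd abe acd ace ade → PointedSigns (!abc) (!abd) (!abe) bcd bce bde →
      PointedSigns abc (!acd) (!ace) (!bcd) (!bce) cde →
      PointedSigns abd acd (!ade) bcd (!bde) (!cde) →
    Mixed abe bce !ace ∨ Mixed abe bde !ade ∨ Mixed ace cde !ade := by
  decide +kernel

section Combinatorial

variable {α : Type*}

/-- An orientation of the triples of distinct points that alternates under permutations. -/
structure IsAlternating (f : α → α → α → Bool) : Prop where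
  rotate : ∀ i j k, f j k i = f i j k
  swap : ∀ {i j k}, i ≠ j → i ≠ k → j ≠ k → f i k j = !f i j k

theorem IsAlternating.swap_left {f : α → α → α → Bool} (hf : IsAlternating f) {i j k : α}
    (hij : i ≠ j) (hik : i ≠ k) (hjk : j ≠ k) : f j i k = !f i j k := by
  rw [hf.rotate k j i, hf.rotate i k j, hf.swap hij hik hjk]

theorem IsAlternating.rotate_back {f : α → α → α → Bool} (hf : IsAlternating f) (i j k : α) :
    f k i j = f i j k :=
  (hf.rotate k i j).symm

/-- The point `a` lies in no triangle spanned by other points. -/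
def OutsideTriangles (f : α → α → α → Bool) (a : α) : Prop :=
  ∀ x y z, Admissible a x y z → Mixed (f a x y) (f a y z) (f a z x)

/-- The counterclockwise radial relation, read off from the orientations. -/
def turn (f : α → α → α → Bool) (i j k l : α) : Bool :=
  majority (f i j k) (f i k l) (f i l j)

/-- Around each point, `f` and `g` induce the same cyclic order up to reversal. -/
def SameTurns (f g : α → α → α → Bool) : Prop :=
  ∀ i, ∃ δ, ∀ j k l, Admissible i j k l → (turn f i j k l ^^ turn g i j k l) = δ

/-- The discrepancy of two orientations at a triple. -/
def discrepancy (f g : α → α → α → Bool) (i j k : α) : Bool := f i j k ^^ g i j k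

variable {f g : α → α → α → Bool}

theorem discrepancy_rotate (hf : IsAlternating f) (hg : IsAlternating g) (i j k : α) :
    discrepancy f g j k i = discrepancy f g i j k := by
  simp only [discrepancy, hf.rotate, hg.rotate]

theorem discrepancy_swap (hf : IsAlternating f) (hg : IsAlternating g) {i j k : α}
    (hij : i ≠ j) (hik : i ≠ k) (hjk : j ≠ k) :
    discrepancy f g i k j = discrepancy f g i j k := by
  simp [discrepancy, hf.swap hij hik hjk, hg.swap hij hik hjk]

theorem OutsideTriangles.pointedSigns (hf : IsAlternating f) {i j k l m : α}
    (hi : OutsideTriangles f i) (hd : [i, j, k, l, m].Nodup) :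
    PointedSigns (f i j k) (f i j l) (f i j m) (f i k l) (f i k m) (f i l m) := by
  simp only [List.nodup_cons, List.mem_cons, List.not_mem_nil, or_false, not_or] at hd
  obtain ⟨⟨ij, ik, il, im⟩, ⟨jk, jl, jm⟩, ⟨kl, km⟩, lm, -⟩ := hd
  simp only [PointedSigns, ← hf.swap ij il jl, ← hf.swap ij im jm, ← hf.swap ik im km]
  exact ⟨hi j k l ⟨ij, ik, il, jk, jl, kl⟩, hi j k m ⟨ij, ik, im, jk, jm, km⟩,
    hi j l m ⟨ij, il, im, jl, jm, lm⟩, hi k l m ⟨ik, il, im, kl, km, lm⟩⟩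

theorem SameTurns.sameCycle (hf : IsAlternating f) (hg : IsAlternating g) (h : SameTurns f g)
    {i j k l m : α} (hd : [i, j, k, l, m].Nodup) :
    SameCycle (f i j k) (f i j l) (f i j m) (f i k l) (f i k m) (f i l m)
      (g i j k) (g i j l) (g i j m) (g i k l) (g i k m) (g i l m) := by
  simp only [List.nodup_cons, List.mem_cons, List.not_mem_nil, or_false, not_or] at hd
  obtain ⟨⟨ij, ik, il, im⟩, ⟨jk, jl, jm⟩, ⟨kl, km⟩, lm, -⟩ := hd
  obtain ⟨δ, hδ⟩ := h i
  refine ⟨δ, ?_⟩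
  simp only [← hf.swap ij il jl, ← hf.swap ij im jm, ← hf.swap ik im km,
    ← hg.swap ij il jl, ← hg.swap ij im jm, ← hg.swap ik im km]
  exact ⟨hδ j k l ⟨ij, ik, il, jk, jl, kl⟩, hδ j k m ⟨ij, ik, im, jk, jm, km⟩,
    hδ j l m ⟨ij, il, im, jl, jm, lm⟩, hδ k l m ⟨ik, il, im, kl, km, lm⟩⟩

/-- Five points whose convex hull has `a, b, c` and a further point as vertices:
the discrepancy is the same at all triples containing `a`. -/
theorem discrepancy_eq_of_outside (hf : IsAlternating f) (hg : IsAlternating g)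
    (h : SameTurns f g) {a b c d e : α} (hd : [a, b, c, d, e].Nodup)
    (ha : OutsideTriangles f a) (hb : OutsideTriangles f b) (hc : OutsideTriangles f c)
    (hout : Mixed (f a b d) (f b c d) (f c a d)) {y z : α}
    (hy : y ∈ [b, c, d, e]) (hz : z ∈ [b, c, d, e]) (hyz : y ≠ z) :
    discrepancy f g a y z = discrepancy f g a b c := by
  have hd' := hd
  simp only [List.nodup_cons, List.mem_cons, List.not_mem_nil, or_false, not_or] at hd'
  obtain ⟨⟨ab, ac, ad, ae⟩, ⟨bc, bd, be⟩, ⟨cd, ce⟩, de, -⟩ := hd'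
  have dB : [b, a, c, d, e].Nodup := by simp; grind
  have dC : [c, a, b, d, e].Nodup := by simp; grind
  have dD : [d, a, b, c, e].Nodup := by simp; grind
  have dE : [e, a, b, c, d].Nodup := by simp; grind
  have A := ha.pointedSigns hf hd
  have B := hb.pointedSigns hf dB
  have C := hc.pointedSigns hf dC
  have sA := h.sameCycle hf hg hd
  have sB := h.sameCycle hf hg dB
  have sC := h.sameCycle hf hg dC
  have sD := h.sameCycle hf hg dD
  have sE := h.sameCycle hf hg dE
  rw [hf.swap_left ac ad cd] at hout
  rw [hf.rotate_back a b c, hf.swap_left ac ad cd, hf.swap_left ac ae ce, hf.swap_left bc bd cd,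
    hf.swap_left bc be ce] at C sC
  rw [hg.rotate_back a b c, hg.swap_left ac ad cd, hg.swap_left ac ae ce, hg.swap_left bc bd cd,
    hg.swap_left bc be ce] at sC
  rw [hf.swap_left ab ac bc, hf.swap_left ab ad bd, hf.swap_left ab ae be] at B sB
  rw [hg.swap_left ab ac bc, hg.swap_left ab ad bd, hg.swap_left ab ae be] at sB
  rw [hf.rotate_back a b d, hf.rotate_back a c d, hf.rotate_back b c d, hf.swap_left ad ae de,
    hf.swap_left bd be de, hf.swap_left cd ce de, hg.rotate_back a b d, hg.rotate_back a c d,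
    hg.rotate_back b c d, hg.swap_left ad ae de, hg.swap_left bd be de,
    hg.swap_left cd ce de] at sD
  simp only [hf.rotate_back _ _ e, hg.rotate_back _ _ e] at sE
  have main := sign_rigidity_of_sameCycle _ _ _ _ _ _ _ _ _ _ A B C hout _ _ _ _ _ _ sA _ _ _ sB
    _ sC sD sE
  simp only [List.mem_cons, List.not_mem_nil, or_false, forall_eq_or_imp, forall_eq] at main
  simp only [List.mem_cons, List.not_mem_nil, or_false] at hy hz
  have sw := @discrepancy_swap α f g hf hg a
  unfold discrepancy at *
  grind

theorem exists_triangle_outside (hf : IsAlternating f) {a b c d e : α}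
    (hd : [a, b, c, d, e].Nodup) (ha : OutsideTriangles f a) (hb : OutsideTriangles f b)
    (hc : OutsideTriangles f c) (hd₀ : OutsideTriangles f d) :
    Mixed (f a b e) (f b c e) (f c a e) ∨ Mixed (f a b e) (f b d e) (f d a e) ∨
      Mixed (f a c e) (f c d e) (f d a e) := by
  have hd' := hd
  simp only [List.nodup_cons, List.mem_cons, List.not_mem_nil, or_false, not_or] at hd'
  obtain ⟨⟨ab, ac, ad, ae⟩, ⟨bc, bd, be⟩, ⟨cd, ce⟩, de, -⟩ := hd'
  have dB : [b, a, c, d, e].Nodup := by simp; grind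
  have dC : [c, a, b, d, e].Nodup := by simp; grind
  have dD : [d, a, b, c, e].Nodup := by simp; grind
  have A := ha.pointedSigns hf hd
  have B := hb.pointedSigns hf dB
  have C := hc.pointedSigns hf dC
  have D := hd₀.pointedSigns hf dD
  rw [hf.rotate_back a b c, hf.swap_left ac ad cd, hf.swap_left ac ae ce, hf.swap_left bc bd cd,
    hf.swap_left bc be ce] at C
  rw [hf.swap_left ab ac bc, hf.swap_left ab ad bd, hf.swap_left ab ae be] at B
  rw [hf.rotate_back a b d, hf.rotate_back a c d, hf.rotate_back b c d, hf.swap_left ad ae de,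
    hf.swap_left bd be de, hf.swap_left cd ce de] at D
  rw [hf.swap_left ac ae ce, hf.swap_left ad ae de]
  exact exists_mixed_of_pointedSigns _ _ _ _ _ _ _ _ _ _ A B C D

/-- With four points outside all triangles, the discrepancy is constant on the triples through
one of them. -/
theorem discrepancy_eq_of_outsideTriangles (hf : IsAlternating f) (hg : IsAlternating g)
    (h : SameTurns f g) {a b c d : α} (hd : [a, b, c, d].Nodup)
    (ha : OutsideTriangles f a) (hb : OutsideTriangles f b)
    (hc : OutsideTriangles f c) (hd₀ : OutsideTriangles f d)
    (hfive : ∃ e, e ∉ [a, b, c, d]) {x y : α} (hax : a ≠ x) (hay : a ≠ y) (hxy : x ≠ y) :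
    discrepancy f g a x y = discrepancy f g a b c := by
  have hd' := hd
  simp only [List.nodup_cons, List.mem_cons, List.not_mem_nil, or_false, not_or] at hd'
  obtain ⟨⟨ab, ac, ad⟩, ⟨bc, bd⟩, cd, -⟩ := hd'
  have key : ∀ e ∉ [a, b, c, d], ∀ y ∈ [b, c, d, e], ∀ z ∈ [b, c, d, e], y ≠ z →
      discrepancy f g a y z = discrepancy f g a b c := by
    intro e he y hy z hz hyz
    simp only [List.mem_cons, List.not_mem_nil, or_false, not_or] at he
    refine discrepancy_eq_of_outside hf hg h (by simp; grind) ha hb hc ?_ hy hz hyz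
    have := hd₀ a b c ⟨Ne.symm ad, Ne.symm bd, Ne.symm cd, ab, ac, bc⟩
    simpa only [hf.rotate_back _ _ d] using this
  by_cases hx : x ∈ [b, c, d]
  · by_cases hy : y ∈ [b, c, d]
    · obtain ⟨e, he⟩ := hfive
      exact key e he x (by grind) y (by grind) hxy
    · exact key y (by grind) x (by grind) y (by grind) hxy
  by_cases hy : y ∈ [b, c, d]
  · exact key x (by grind) x (by grind) y (by grind) hxy
  have hx' : x ∉ [a, b, c, d] := by grind
  simp only [List.mem_cons, List.not_mem_nil, or_false, not_or] at hx hy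
  rcases exists_triangle_outside hf (e := x) (by simp; grind) ha hb hc hd₀ with H | H | H
  · exact discrepancy_eq_of_outside hf hg h (e := y) (by simp; grind) ha hb hc H
      (by simp) (by simp) hxy
  · rw [← key x hx' b (by simp) d (by simp) bd]
    exact discrepancy_eq_of_outside hf hg h (e := y) (by simp; grind) ha hb hd₀ H
      (by simp) (by simp) hxy
  · rw [← key x hx' c (by simp) d (by simp) cd]
    exact discrepancy_eq_of_outside hf hg h (e := y) (by simp; grind) ha hc hd₀ H
      (by simp) (by simp) hxy

/-- The discrepancy at `x, y, z` is that of the triples through a point `a`, provided the line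
`xa` does not separate `y` and `z`. -/
theorem discrepancy_eq_of_same_side (h : SameTurns f g) {x y z a b c : α} {ε : Bool}
    (hy : Admissible x a y z) (hb : Admissible x a b c)
    (hf : IsAlternating f) (hg : IsAlternating g)
    (hε : ∀ i ∈ [a, b, c], ∀ j k, i ≠ j → i ≠ k → j ≠ k → discrepancy f g i j k = ε)
    (hside : f x a y = f x a z) : discrepancy f g x y z = ε := by
  obtain ⟨δ, hδ⟩ := h x
  have h₁ := hδ _ _ _ hy
  have h₂ := hδ _ _ _ hb
  obtain ⟨xa, xy, xz, ay, az, yz⟩ := hy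
  obtain ⟨-, xb, xc, ab, ac, bc⟩ := hb
  have e₁ := hε a (by simp) y x ay xa.symm xy.symm
  have e₂ := hε a (by simp) z x az xa.symm xz.symm
  have e₃ := hε a (by simp) b x ab xa.symm xb.symm
  have e₄ := hε b (by simp) c x bc xb.symm xc.symm
  have e₅ := hε c (by simp) a x ac.symm xc.symm xa.symm
  have s₁ := hf.swap xa xz az
  have s₂ := hg.swap xa xz az
  simp only [discrepancy, turn, hf.rotate x, hg.rotate x] at *
  revert h₁ h₂ e₁ e₂ e₃ e₄ e₅
  rw [s₁, s₂, hside]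
  generalize f x a z = p₁, f x y z = p₂, f x a b = p₃, f x b c = p₄, f x c a = p₅,
    g x a y = q₀, g x a z = q₁, g x y z = q₂, g x a b = q₃, g x b c = q₄, g x c a = q₅
  clear hε hδ
  revert p₁ p₂ p₃ p₄ p₅ q₀ q₁ q₂ q₃ q₄ q₅ δ ε
  decide +kernel

/-- With four points outside all triangles and a fifth point, the discrepancy is constant. -/
theorem exists_discrepancy_eq (hf : IsAlternating f) (hg : IsAlternating g)
    (h : SameTurns f g) {a b c d : α} (hd : [a, b, c, d].Nodup)
    (hout : ∀ u ∈ [a, b, c, d], OutsideTriangles f u) (hfive : ∃ e, e ∉ [a, b, c, d]) :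
    ∃ ε, ∀ x y z, x ≠ y → x ≠ z → y ≠ z → discrepancy f g x y z = ε := by
  have hd' := hd
  simp only [List.nodup_cons, List.mem_cons, List.not_mem_nil, or_false, not_or] at hd'
  obtain ⟨⟨ab, ac, ad⟩, ⟨bc, bd⟩, cd, -⟩ := hd'
  have rot := discrepancy_rotate hf hg
  have ha := hout a (by simp)
  have hb := hout b (by simp)
  have hc := hout c (by simp)
  have hd₀ := hout d (by simp)
  have through : ∀ u ∈ [a, b, c], ∀ x y, u ≠ x → u ≠ y → x ≠ y →
      discrepancy f g u x y = discrepancy f g a b c := by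
    intro u hu x y hux huy hxy
    simp only [List.mem_cons, List.not_mem_nil, or_false] at hu
    rcases hu with rfl | rfl | rfl
    · exact discrepancy_eq_of_outsideTriangles hf hg h hd ha hb hc hd₀ hfive hux huy hxy
    · rw [← rot a]
      exact discrepancy_eq_of_outsideTriangles hf hg h (d := d) (by simp; grind) hb hc ha hd₀
        (by simpa [and_assoc, and_left_comm] using hfive) hux huy hxy
    · rw [← rot a, ← rot b]
      exact discrepancy_eq_of_outsideTriangles hf hg h (d := d) (by simp; grind) hc ha hb hd₀
        (by simpa [and_assoc, and_left_comm] using hfive) hux huy hxy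
  refine ⟨discrepancy f g a b c, fun x y z xy xz yz => ?_⟩
  by_cases hx : x ∈ [a, b, c]
  · exact through x hx y z xy xz yz
  by_cases hy : y ∈ [a, b, c]
  · rw [← rot x]
    exact through y hy z x yz xy.symm xz.symm
  by_cases hz : z ∈ [a, b, c]
  · rw [← rot x, ← rot y]
    exact through z hz x y xz.symm yz.symm xy
  simp only [List.mem_cons, List.not_mem_nil, or_false, not_or] at hx hy hz
  have side : ∀ p q r, p ∉ [a, b, c] → q ∉ [a, b, c] → r ∉ [a, b, c] → p ≠ q → p ≠ r → q ≠ r →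
      f p a q = f p a r → discrepancy f g p q r = discrepancy f g a b c := by
    intro p q r hp hq hr pq pr qr hs
    refine discrepancy_eq_of_same_side h (b := b) (c := c) ?_ ?_ hf hg through hs <;>
      unfold Admissible <;> grind
  have mixed := ha x y z ⟨Ne.symm hx.1, Ne.symm hy.1, Ne.symm hz.1, xy, xz, yz⟩
  have : f x a y = f x a z ∨ f y a z = f y a x ∨ f z a x = f z a y := by
    rw [hf.swap_left (Ne.symm hx.1) (Ne.symm hy.1) xy,
      hf.swap_left (Ne.symm hy.1) (Ne.symm hz.1) yz,
      hf.swap_left (Ne.symm hz.1) (Ne.symm hx.1) (Ne.symm xz),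
      hf.rotate z x a, hf.rotate a z x, hf.rotate x y a, hf.rotate a x y, hf.rotate y z a,
      hf.rotate a y z]
    revert mixed
    generalize f a x y = p, f a y z = q, f a z x = r
    revert p q r
    decide
  rcases this with H | H | H
  · exact side x y z (by grind) (by grind) (by grind) xy xz yz H
  · rw [← rot x]
    exact side y z x (by grind) (by grind) (by grind) yz xy.symm xz.symm H
  · rw [← rot x, ← rot y]
    exact side z x y (by grind) (by grind) (by grind) xz.symm yz.symm xy H

end Combinatorial

theorem chi_eq_one_iff {α : Type*} (P : α → ℝ × ℝ) (i j k : α) :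
    chi P i j k = 1 ↔ 0 < det2 (P j - P i) (P k - P i) := by
  unfold chi Real.sign
  split_ifs <;> norm_num <;> linarith

/-- The orientation of triples in a configuration: `true` for counterclockwise triples. -/
noncomputable def orientation {α : Type*} (P : α → ℝ × ℝ) (i j k : α) : Bool :=
  decide (0 < det2 (P j - P i) (P k - P i))

theorem isAlternating_orientation {α : Type*} {P : α → ℝ × ℝ} (hP : GenPos P) :
    IsAlternating (orientation P) where
  rotate i j k := by
    have : det2 (P k - P j) (P i - P j) = det2 (P j - P i) (P k - P i) := by
      simp only [det2, Prod.fst_sub, Prod.snd_sub]; ring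
    simp only [orientation, this]
  swap {i j k} hij hik hjk := by
    have h := hP i j k hij hik hjk
    have hne : det2 (P j - P i) (P k - P i) ≠ 0 := by
      rwa [chi, Ne, Real.sign_eq_zero_iff] at h
    have : det2 (P k - P i) (P j - P i) = -det2 (P j - P i) (P k - P i) := by
      simp only [det2]; ring
    rw [orientation, orientation, this, ← decide_not, decide_eq_decide, Left.neg_pos_iff, not_lt]
    exact ⟨le_of_lt, fun h' => lt_of_le_of_ne h' hne⟩

theorem ccw_iff_turn {α : Type*} (P : α → ℝ × ℝ) (i j k l : α) :
    Ccw P i j k l ↔ turn (orientation P) i j k l = true := by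
  simp only [Ccw, chi_eq_one_iff, turn, majority, orientation, Bool.or_eq_true, Bool.and_eq_true,
    decide_eq_true_eq, or_assoc]

theorem turn_reverse {α : Type*} {f : α → α → α → Bool} (hf : IsAlternating f) {i j k l : α}
    (h : Admissible i j k l) : turn f i l k j = !turn f i j k l := by
  obtain ⟨ij, ik, il, jk, jl, kl⟩ := h
  simp only [turn, hf.swap ij ik jk, hf.swap ik il kl, hf.swap il ij jl.symm]
  generalize f i j k = p, f i k l = q, f i l j = r
  revert p q r
  decide

theorem SameUndirected.sameTurns {α : Type*} {P Q : α → ℝ × ℝ} (hP : GenPos P)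
    (h : SameUndirected P Q) : SameTurns (orientation P) (orientation Q) := by
  intro i
  rcases h i with H | H
  · refine ⟨false, fun j k l hd => ?_⟩
    have := H j k l hd
    rw [ccw_iff_turn, ccw_iff_turn, Bool.coe_iff_coe] at this
    simp [this]
  · refine ⟨true, fun j k l hd => ?_⟩
    have := H j k l hd
    rw [ccw_iff_turn, ccw_iff_turn, Bool.coe_iff_coe,
      turn_reverse (isAlternating_orientation hP) hd] at this
    simp [this]

theorem mem_convexHull_of_smul_eq {s : Set (ℝ × ℝ)} {p x y z : ℝ × ℝ} {u v w : ℝ}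
    (hx : x ∈ s) (hy : y ∈ s) (hz : z ∈ s) (hu : 0 ≤ u) (hv : 0 ≤ v) (hw : 0 ≤ w)
    (hpos : 0 < u + v + w) (h : (u + v + w) • p = u • x + v • y + w • z) :
    p ∈ convexHull ℝ s := by
  have hc := convex_convexHull ℝ s
  have hm := hc.sum_mem (t := Finset.univ) (w := ![u / (u + v + w), v / (u + v + w),
    w / (u + v + w)]) (z := ![x, y, z])
    (by intro i _; fin_cases i <;> simp <;> positivity)
    (by simp [Fin.sum_univ_three]; field_simp)
    (by intro i _; fin_cases i <;> simp <;> exact subset_convexHull ℝ s ‹_›)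
  have : p = (u + v + w)⁻¹ • (u • x + v • y + w • z) := by
    rw [← h, inv_smul_smul₀ hpos.ne']
  rw [this]
  simpa [Fin.sum_univ_three, smul_smul, div_eq_inv_mul] using hm

theorem outsideTriangles_of_mem_extremeSet {α : Type*} {P : α → ℝ × ℝ} (hP : GenPos P) {a : α}
    (ha : a ∈ ExtremeSet P) : OutsideTriangles (orientation P) a := by
  rintro x y z ⟨ax, ay, az, xy, xz, yz⟩ ⟨h₁, h₂⟩
  apply ha
  have hx : P x ∈ P '' {j | j ≠ a} := ⟨x, ax.symm, rfl⟩
  have hy : P y ∈ P '' {j | j ≠ a} := ⟨y, ay.symm, rfl⟩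
  have hz : P z ∈ P '' {j | j ≠ a} := ⟨z, az.symm, rfl⟩
  have hne : det2 (P x - P a) (P y - P a) ≠ 0 := by
    have h := hP a x y ax ay xy
    rwa [chi, Ne, Real.sign_eq_zero_iff] at h
  rw [orientation, orientation, decide_eq_decide] at h₁ h₂
  have hsum : (det2 (P y - P a) (P z - P a) + det2 (P z - P a) (P x - P a) +
      det2 (P x - P a) (P y - P a)) • P a = det2 (P y - P a) (P z - P a) • P x +
      det2 (P z - P a) (P x - P a) • P y + det2 (P x - P a) (P y - P a) • P z := by
    ext <;> simp [det2] <;> ring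
  rcases lt_or_gt_of_ne hne with h | h
  · have h₁' := not_lt.1 (mt h₁.2 h.not_gt)
    have h₂' := not_lt.1 (mt h₂.2 h₁'.not_gt)
    refine mem_convexHull_of_smul_eq hx hy hz (neg_nonneg.2 h₁') (neg_nonneg.2 h₂')
      (neg_nonneg.2 h.le) (by linarith) ?_
    simp only [neg_smul, ← neg_add, hsum]
  · have h₁' := h₁.1 h
    exact mem_convexHull_of_smul_eq hx hy hz h₁'.le (h₂.1 h₁').le h.le
      (by linarith [h₂.1 h₁']) hsum

theorem chi_eq_ite_orientation {α : Type*} {P : α → ℝ × ℝ} (hP : GenPos P) {i j k : α}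
    (hij : i ≠ j) (hik : i ≠ k) (hjk : j ≠ k) :
    chi P i j k = if orientation P i j k then 1 else -1 := by
  split_ifs with h
  · rw [chi_eq_one_iff]
    simpa [orientation] using h
  · rcases Real.sign_apply_eq (det2 (P j - P i) (P k - P i)) with h' | h' | h'
    · exact h'
    · exact absurd h' (hP i j k hij hik hjk)
    · exact absurd ((chi_eq_one_iff P i j k).1 h') (by simpa [orientation] using h)

theorem chi_eq_zero {α : Type*} (P : α → ℝ × ℝ) {i j k : α} (h : ¬(i ≠ j ∧ i ≠ k ∧ j ≠ k)) :
    chi P i j k = 0 := by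
  have : i = j ∨ i = k ∨ j = k := by tauto
  rw [chi, Real.sign_eq_zero_iff]
  rcases this with rfl | rfl | rfl <;> simp [det2]
  ring

/-- if two configurations have the same undirected radial system
and the extreme set of `P` has at least 4 elements, then the chirotopes are
equivalent. -/
theorem undirected_big_hull_determines_order_type {n : ℕ} (hn : 5 ≤ n)
    (P Q : Fin n → ℝ × ℝ)
    (hPinj : Function.Injective P) (hPgp : GenPos P)
    (hQinj : Function.Injective Q) (hQgp : GenPos Q)
    (hU : SameUndirected P Q)
    (hext : 4 ≤ (ExtremeSet P).ncard) :
    (∀ i j k : Fin n, chi P i j k = chi Q i j k) ∨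
    (∀ i j k : Fin n, chi P i j k = - chi Q i j k) := by
  obtain ⟨S, hS, hcard⟩ := Set.exists_subset_card_eq hext
  obtain ⟨a, b, c, d, ab, ac, ad, bc, bd, cd, rfl⟩ := Set.ncard_eq_four.1 hcard
  have hfive : ∃ e, e ∉ [a, b, c, d] := by
    have hlt : ([a, b, c, d].toFinset).card < Fintype.card (Fin n) := by
      have := List.toFinset_card_le [a, b, c, d]
      simp only [List.length_cons, List.length_nil, Fintype.card_fin] at this ⊢
      omega
    obtain ⟨e, he⟩ := Finset.exists_mem_notMem_of_card_lt_card
      (s := [a, b, c, d].toFinset) (t := Finset.univ) (by simpa using hlt)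
    exact ⟨e, by simpa using he⟩
  obtain ⟨ε, hε⟩ := exists_discrepancy_eq (isAlternating_orientation hPgp)
    (isAlternating_orientation hQgp) (hU.sameTurns hPgp) (a := a) (b := b) (c := c) (d := d)
    (by simp; grind)
    (fun u hu => outsideTriangles_of_mem_extremeSet hPgp (hS (by simpa using hu))) hfive
  cases ε
  · refine Or.inl fun i j k => ?_
    by_cases h : i ≠ j ∧ i ≠ k ∧ j ≠ k
    · obtain ⟨ij, ik, jk⟩ := h
      have := hε i j k ij ik jk
      rw [discrepancy, bne_eq_false_iff_eq] at this
      rw [chi_eq_ite_orientation hPgp ij ik jk, chi_eq_ite_orientation hQgp ij ik jk, this]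
    · rw [chi_eq_zero P h, chi_eq_zero Q h]
  · refine Or.inr fun i j k => ?_
    by_cases h : i ≠ j ∧ i ≠ k ∧ j ≠ k
    · obtain ⟨ij, ik, jk⟩ := h
      have := hε i j k ij ik jk
      rw [discrepancy] at this
      rw [chi_eq_ite_orientation hPgp ij ik jk, chi_eq_ite_orientation hQgp ij ik jk]
      revert this
      cases orientation P i j k <;> cases orientation Q i j k <;> simp
    · rw [chi_eq_zero P h, chi_eq_zero Q h, neg_zero]
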